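/- The inclusion FLP(P) ⊆ SFLP(P) is strict in general: there exist a general program P and an interpretation I such that I is an SFLP answer set of P but not an FLP answer set of P. Concretely, for P = {a ← A; b ← A}, where A is the generalized atom COUNT({a,b}) ≠ 1, the interpretation {a,b} is an SFLP answer set of P but not an FLP answer set of P. -/

import Mathlib

/-- A general rule: a finite set of atoms as (disjunctive) head,
and a generalized atom (a mapping from interpretations to truth values) as body. -/
structure GRule (B : Type*) where
  head : Finset B
  body : Set B → Prop

variable {B : Type*}

/-- `I ⊨ r`: whenever the body is true in `I`, some head atom is true in `I`. -/
def satRule (I : Set B) (r : GRule B) : Prop :=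
  r.body I → (I ∩ ↑r.head).Nonempty

/-- `I ⊨ P`. -/
def satProg (I : Set B) (P : Set (GRule B)) : Prop :=
  ∀ r ∈ P, satRule I r

/-- The FLP reduct `P^I`. -/
def reduct (P : Set (GRule B)) (I : Set B) : Set (GRule B) :=
  {r ∈ P | r.body I}

/-- `I ⊨_s P`: `I` is a supported model of `P`. -/
def suppModel (I : Set B) (P : Set (GRule B)) : Prop :=
  satProg I P ∧ ∀ a ∈ I, ∃ r ∈ P, r.body I ∧ I ∩ ↑r.head = {a}

/-- `I` is an FLP answer set of `P`. -/
def isFLP (I : Set B) (P : Set (GRule B)) : Prop :=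
  satProg I P ∧ ∀ J : Set B, J ⊂ I → ¬ satProg J (reduct P I)

/-- `I` is an SFLP answer set of `P`. -/
def isSFLP (I : Set B) (P : Set (GRule B)) : Prop :=
  suppModel I P ∧ ∀ J : Set B, J ⊂ I → ¬ suppModel J (reduct P I)

/-- For P = {a ← A; b ← A} with A = COUNT({a,b}) ≠ 1 and a ≠ b,
the interpretation {a,b} is an SFLP answer set of P but not an FLP answer set. -/
theorem stmt1 {B : Type*} (a b : B) (hab : a ≠ b)
    (A : Set B → Prop) (hA : ∀ I : Set B, A I ↔ (I ∩ {a, b}).ncard ≠ 1)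
    (P : Set (GRule B)) (hP : P = {⟨{a}, A⟩, ⟨{b}, A⟩}) :
    isSFLP {a, b} P ∧ ¬ isFLP {a, b} P := by
  subst hP
  have hI : A {a, b} := by
    rw [hA, Set.inter_self, Set.ncard_pair hab]; decide
  have hE : A ∅ := by
    rw [hA]; simp
  have hSa : ¬ A {a} := by
    rw [hA, not_not]
    have : ({a} : Set B) ∩ {a, b} = {a} := by
      ext x; simp only [Set.mem_inter_iff, Set.mem_insert_iff, Set.mem_singleton_iff]; tauto
    rw [this, Set.ncard_singleton]
  have hsat : satProg ({a, b} : Set B) {⟨{a}, A⟩, ⟨{b}, A⟩} := by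
    rintro r (rfl | rfl) _
    · exact ⟨a, by simp⟩
    · exact ⟨b, by simp⟩
  refine ⟨⟨⟨hsat, ?_⟩, ?_⟩, ?_⟩
  · rintro x (rfl | rfl)
    · refine ⟨⟨{x}, A⟩, Or.inl rfl, hI, ?_⟩
      ext y; simp only [Finset.coe_singleton, Set.mem_inter_iff, Set.mem_insert_iff, Set.mem_singleton_iff]; tauto
    · refine ⟨⟨{x}, A⟩, Or.inr rfl, hI, ?_⟩
      ext y; simp only [Finset.coe_singleton, Set.mem_inter_iff, Set.mem_insert_iff, Set.mem_singleton_iff]; tauto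
  · rintro J hJ ⟨h1, h2⟩
    have key : ¬ A J := by
      intro hAJ
      obtain ⟨x, hx, hxa⟩ := h1 ⟨{a}, A⟩ ⟨Or.inl rfl, hI⟩ hAJ
      obtain ⟨y, hy, hyb⟩ := h1 ⟨{b}, A⟩ ⟨Or.inr rfl, hI⟩ hAJ
      have hxa' : x = a := by simpa using hxa
      have hyb' : y = b := by simpa using hyb
      subst hxa' hyb'
      apply hJ.2
      rintro z (rfl | rfl) <;> assumption
    have hJe : J = ∅ := by
      rw [Set.eq_empty_iff_forall_notMem]
      intro x hx
      obtain ⟨r, ⟨hr, _⟩, hb, _⟩ := h2 x hx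
      rcases hr with rfl | rfl <;> exact key hb
    exact key (hJe ▸ hE)
  · rintro ⟨_, h⟩
    refine h {a} ⟨by simp, fun hh => hab ?_⟩ ?_
    · have : b ∈ ({a} : Set B) := hh (Or.inr rfl)
      exact (Set.mem_singleton_iff.1 this).symm
    · rintro r ⟨hr, _⟩ hb
      rcases hr with rfl | rfl <;> exact absurd hb hSa
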